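/- arXiv:1009.2954 — 2 statements merged into one kernel-verified Lean document; each statement's English description precedes it below -/
import Mathlib

section
/- Let (xₙ)_{n≥1} be a real sequence, L ∈ ℝ and σ ∈ (0,1]. If i(xₙ;L) ≥ σ, then there exists a strictly increasing map k : ℕ → ℕ such that the subsequence (x_{k(n)})_{n≥1} converges to L and the set {k(n) : n ∈ ℕ} has lower density δ₋({k(n) : n ∈ ℕ}) ≥ σ. -/
open Filter Topology MeasureTheory
open scoped Pointwise

/-- Lower (asymptotic) density of a set of naturals:
`liminf_n |K ∩ {1,…,n}|/n`. -/
noncomputable def lowerDensity (K : Set ℕ) : ℝ :=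
  Filter.liminf (fun n : ℕ => (Nat.card ↥(K ∩ Set.Icc 1 n) : ℝ) / n) Filter.atTop

/-- Upper (asymptotic) density of a set of naturals:
`limsup_n |K ∩ {1,…,n}|/n`. -/
noncomputable def upperDensity (K : Set ℕ) : ℝ :=
  Filter.limsup (fun n : ℕ => (Nat.card ↥(K ∩ Set.Icc 1 n) : ℝ) / n) Filter.atTop

/-- Index of convergence of a real sequence to a real number `L`:
`i(xₙ;L) = 1 - sup_{ε>0} δ₊({n : |xₙ - L| ≥ ε})`. -/
noncomputable def convIndex (x : ℕ → ℝ) (L : ℝ) : ℝ :=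
  1 - ⨆ ε : {e : ℝ // 0 < e}, upperDensity {n | ε.1 ≤ |x n - L|}

lemma countRatio_nonneg (K : Set ℕ) (n : ℕ) :
    0 ≤ (Nat.card ↥(K ∩ Set.Icc 1 n) : ℝ) / n := by positivity

lemma card_inter_Icc_le (K : Set ℕ) (n : ℕ) : Nat.card ↥(K ∩ Set.Icc 1 n) ≤ n := by
  have h := Nat.card_mono (Set.finite_Icc 1 n) (Set.inter_subset_right : K ∩ Set.Icc 1 n ⊆ _)
  simpa using h

lemma countRatio_le_one (K : Set ℕ) (n : ℕ) :
    (Nat.card ↥(K ∩ Set.Icc 1 n) : ℝ) / n ≤ 1 :=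
  div_le_one_of_le₀ (mod_cast card_inter_Icc_le K n) (Nat.cast_nonneg n)

lemma isBoundedUnder_le_countRatio (K : Set ℕ) :
    IsBoundedUnder (· ≤ ·) atTop (fun n : ℕ => (Nat.card ↥(K ∩ Set.Icc 1 n) : ℝ) / n) :=
  isBoundedUnder_of ⟨1, countRatio_le_one K⟩

lemma isBoundedUnder_ge_countRatio (K : Set ℕ) :
    IsBoundedUnder (· ≥ ·) atTop (fun n : ℕ => (Nat.card ↥(K ∩ Set.Icc 1 n) : ℝ) / n) :=
  isBoundedUnder_of ⟨0, countRatio_nonneg K⟩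

lemma upperDensity_le_one (K : Set ℕ) : upperDensity K ≤ 1 :=
  limsup_le_of_le (isBoundedUnder_ge_countRatio K).isCoboundedUnder_le
    (Eventually.of_forall (countRatio_le_one K))

lemma le_card_inter_Icc_add_card_compl (K : Set ℕ) (n : ℕ) :
    n ≤ Nat.card ↥(K ∩ Set.Icc 1 n) + Nat.card ↥(Kᶜ ∩ Set.Icc 1 n) := by
  have h := Set.ncard_union_le (K ∩ Set.Icc 1 n) (Kᶜ ∩ Set.Icc 1 n)
  rw [← Set.union_inter_distrib_right, Set.union_compl_self, Set.univ_inter,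
    ← Nat.card_coe_set_eq (Set.Icc 1 n)] at h
  simpa using h

lemma lowerDensity_of_finite {K : Set ℕ} (hK : K.Finite) : lowerDensity K = 0 := by
  refine Tendsto.liminf_eq (squeeze_zero (countRatio_nonneg K) (fun n => ?_)
    (tendsto_const_div_atTop_nhds_zero_nat (Nat.card K : ℝ)))
  have := Nat.card_mono hK (Set.inter_subset_left : K ∩ Set.Icc 1 n ⊆ K)
  gcongr

/-- Given an increasing sequence of sets of upper density at most `1 - σ`, there is a set of lower
density at least `σ` that meets each of them in a finite set. -/
lemma exists_le_lowerDensity_of_monotone {A : ℕ → Set ℕ} (hA : Monotone A) {σ : ℝ}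
    (h : ∀ m, upperDensity (A m) ≤ 1 - σ) :
    ∃ K : Set ℕ, σ ≤ lowerDensity K ∧ ∀ m, ∀ᶠ n in atTop, n ∈ K → n ∉ A m := by
  have hN : ∀ m : ℕ, ∃ N, ∀ k ≥ N, ∀ n ≥ k,
      (Nat.card ↥(A m ∩ Set.Icc 1 n) : ℝ) / n < 1 - σ + 1 / ((m : ℝ) + 1) := by
    intro m
    have hlt : upperDensity (A m) < 1 - σ + 1 / ((m : ℝ) + 1) :=
      (h m).trans_lt (lt_add_of_pos_right _ Nat.one_div_pos_of_nat)
    obtain ⟨N, hN⟩ := eventually_atTop.1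
      (eventually_lt_of_limsup_lt hlt (isBoundedUnder_le_countRatio _))
    exact ⟨N, fun k hk n hn => hN n (hk.trans hn)⟩
  obtain ⟨N, hNmono, hN⟩ := extraction_forall_of_eventually' hN
  refine ⟨{n | ∀ m, N m ≤ n → n ∉ A m}, ?_,
    fun m => (eventually_ge_atTop (N m)).mono fun n hn hnK => hnK m hn⟩
  set K : Set ℕ := {n | ∀ m, N m ≤ n → n ∉ A m}
  refine le_of_forall_lt fun c hc => ?_
  obtain ⟨c', hcc', hc'⟩ := exists_between hc
  refine hcc'.trans_le (le_liminf_of_le (isBoundedUnder_le_countRatio K).isCoboundedUnder_ge ?_)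
  obtain ⟨m, hm⟩ := exists_nat_one_div_lt (sub_pos.2 hc')
  filter_upwards [eventually_ge_atTop (N m), eventually_gt_atTop 0] with n hn hn0
  set M := Nat.findGreatest (fun j => N j ≤ n) n
  have hmM : m ≤ M := Nat.le_findGreatest (hNmono.le_apply.trans hn) hn
  have hNM : N M ≤ n :=
    Nat.findGreatest_spec (P := fun j => N j ≤ n) (hNmono.le_apply.trans hn) hn
  have hsub : Kᶜ ∩ Set.Icc 1 n ⊆ A M ∩ Set.Icc 1 n := by
    rintro a ⟨ha, han⟩
    simp only [K, Set.mem_compl_iff, Set.mem_ofPred_eq, not_forall, not_not] at ha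
    obtain ⟨j, hj, haj⟩ := ha
    have hjn : N j ≤ n := hj.trans han.2
    exact ⟨hA (Nat.le_findGreatest (hNmono.le_apply.trans hjn) hjn) haj, han⟩
  have hcard := Nat.card_mono ((Set.finite_Icc 1 n).inter_of_right _) hsub
  have hsplit : (n : ℝ) ≤ Nat.card ↥(K ∩ Set.Icc 1 n) + Nat.card ↥(A M ∩ Set.Icc 1 n) := by
    exact_mod_cast (le_card_inter_Icc_add_card_compl K n).trans (by gcongr)
  have hn0' : (0 : ℝ) < n := by exact_mod_cast hn0
  have hbad := hN M n hNM
  have hM : 1 / ((M : ℝ) + 1) ≤ 1 / ((m : ℝ) + 1) := Nat.one_div_le_one_div hmM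
  have hone : 1 ≤ (Nat.card ↥(K ∩ Set.Icc 1 n) : ℝ) / n +
      (Nat.card ↥(A M ∩ Set.Icc 1 n) : ℝ) / n := by
    rwa [← add_div, one_le_div hn0']
  linarith

lemma upperDensity_le_one_sub_convIndex (x : ℕ → ℝ) (L : ℝ) {ε : ℝ} (hε : 0 < ε) :
    upperDensity {n | ε ≤ |x n - L|} ≤ 1 - convIndex x L := by
  rw [convIndex, sub_sub_cancel]
  exact le_ciSup (f := fun e : {e : ℝ // 0 < e} => upperDensity {n | e.1 ≤ |x n - L|})
    ⟨1, Set.forall_mem_range.2 fun _ => upperDensity_le_one _⟩ ⟨ε, hε⟩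

theorem exists_subseq_of_convIndex_ge (x : ℕ → ℝ) (L σ : ℝ)
    (hσ : σ ∈ Set.Ioc (0 : ℝ) 1) (h : σ ≤ convIndex x L) :
    ∃ k : ℕ → ℕ, StrictMono k ∧
      Tendsto (fun n => x (k n)) atTop (𝓝 L) ∧
      σ ≤ lowerDensity (Set.range k) := by
  have hA : Monotone fun m : ℕ => {n | 1 / ((m : ℝ) + 1) ≤ |x n - L|} :=
    fun a b hab n hn => Set.mem_ofPred_eq.mpr ((Nat.one_div_le_one_div hab).trans hn)
  obtain ⟨K, hKσ, hK⟩ := exists_le_lowerDensity_of_monotone hA fun m =>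
    (upperDensity_le_one_sub_convIndex x L Nat.one_div_pos_of_nat).trans (sub_le_sub_left h 1)
  have hinf : K.Infinite := fun hfin =>
    (hσ.1.trans_le hKσ).ne' (lowerDensity_of_finite hfin)
  have hmono : StrictMono (Nat.nth (· ∈ K)) := Nat.nth_strictMono hinf
  refine ⟨Nat.nth (· ∈ K), hmono, ?_, ?_⟩
  · refine Metric.tendsto_nhds.2 fun ε hε => ?_
    obtain ⟨m, hm⟩ := exists_nat_one_div_lt hε
    filter_upwards [hmono.tendsto_atTop.eventually (hK m)] with n hn
    exact (not_le.1 (hn (Nat.nth_mem_of_infinite hinf n))).trans hm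
  · exact (Nat.range_nth_of_infinite (p := (· ∈ K)) hinf).symm ▸ hKσ
end

section
/- Let (xₙ)_{n≥1} be a real sequence and (Lₘ)_{m≥1} a sequence of pairwise distinct real numbers with i(xₙ;Lₘ) = αₘ for every m ≥ 1 and Σ_{k=1}^∞ α_k = 1. Then for every real number L different from all the Lₘ one has i(xₙ;L) = 0; moreover every strictly increasing k : ℕ → ℕ for which (x_{k(n)})_{n≥1} converges to such an L satisfies δ₋({k(n) : n ∈ ℕ}) = 0. -/
open Filter Topology MeasureTheory
open scoped Pointwise

lemma natCard_inter_Icc_div_mem (K : Set ℕ) (n : ℕ) :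
    (Nat.card ↥(K ∩ Set.Icc 1 n) : ℝ) / n ∈ Set.Icc (0 : ℝ) 1 := by
  refine ⟨by positivity, div_le_one_of_le₀ ?_ (Nat.cast_nonneg n)⟩
  have h := Set.ncard_le_ncard (Set.inter_subset_right : K ∩ Set.Icc 1 n ⊆ _)
  rw [Set.ncard_eq_toFinset_card' (Set.Icc 1 n)] at h
  rw [Nat.card_coe_set_eq]
  simpa using h

lemma isBoundedUnder_le_density (K : Set ℕ) :
    IsBoundedUnder (· ≤ ·) atTop fun n : ℕ => (Nat.card ↥(K ∩ Set.Icc 1 n) : ℝ) / n :=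
  isBoundedUnder_of ⟨1, fun n => (natCard_inter_Icc_div_mem K n).2⟩

lemma isBoundedUnder_ge_density (K : Set ℕ) :
    IsBoundedUnder (· ≥ ·) atTop fun n : ℕ => (Nat.card ↥(K ∩ Set.Icc 1 n) : ℝ) / n :=
  isBoundedUnder_of ⟨0, fun n => (natCard_inter_Icc_div_mem K n).1⟩

lemma lowerDensity_nonneg (K : Set ℕ) : 0 ≤ lowerDensity K :=
  le_liminf_of_le (isBoundedUnder_le_density K).isCoboundedUnder_ge
    (Eventually.of_forall fun n => (natCard_inter_Icc_div_mem K n).1)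

lemma lowerDensity_le_one (K : Set ℕ) : lowerDensity K ≤ 1 :=
  liminf_le_of_le (isBoundedUnder_ge_density K) fun _ hb =>
    let ⟨n, hn⟩ := hb.exists
    hn.trans (natCard_inter_Icc_div_mem K n).2

lemma natCard_union_inter_Icc {A B : Set ℕ} (h : Disjoint A B) (n : ℕ) :
    Nat.card ↥((A ∪ B) ∩ Set.Icc 1 n) =
      Nat.card ↥(A ∩ Set.Icc 1 n) + Nat.card ↥(B ∩ Set.Icc 1 n) := by
  simp only [Nat.card_coe_set_eq]
  rw [Set.union_inter_distrib_right]
  exact Set.ncard_union_eq (h.mono Set.inter_subset_left Set.inter_subset_left)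
    ((Set.finite_Icc 1 n).inter_of_right A) ((Set.finite_Icc 1 n).inter_of_right B)

lemma upperDensity_compl (K : Set ℕ) : upperDensity Kᶜ = 1 - lowerDensity K := by
  unfold upperDensity lowerDensity
  rw [← limsup_const_sub _ _ _ (isBoundedUnder_le_density K).isCoboundedUnder_ge
    (isBoundedUnder_ge_density K)]
  refine limsup_congr ?_
  filter_upwards [eventually_gt_atTop 0] with n hn
  have h := natCard_union_inter_Icc (disjoint_compl_right : Disjoint K Kᶜ) n
  rw [Set.union_compl_self, Set.univ_inter, Nat.card_coe_set_eq,
    Set.ncard_eq_toFinset_card'] at h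
  replace h : (n : ℝ) = Nat.card ↥(K ∩ Set.Icc 1 n) + Nat.card ↥(Kᶜ ∩ Set.Icc 1 n) := by
    exact_mod_cast (by simpa using h)
  have hn' : (n : ℝ) ≠ 0 := by positivity
  rw [eq_sub_iff_add_eq, ← add_div, add_comm, ← h, div_self hn']

lemma lowerDensity_add_le {A B : Set ℕ} (h : Disjoint A B) :
    lowerDensity A + lowerDensity B ≤ lowerDensity (A ∪ B) := by
  refine (le_liminf_add (isBoundedUnder_ge_density A) (isBoundedUnder_le_density A)
    (isBoundedUnder_ge_density B) (isBoundedUnder_le_density B).isCoboundedUnder_ge).trans_eq ?_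
  refine congrArg (fun u => liminf u atTop) (funext fun n => ?_)
  simp only [Pi.add_apply, natCard_union_inter_Icc h, Nat.cast_add, add_div]

lemma sum_lowerDensity_le {ι : Type*} (s : Finset ι) (A : ι → Set ℕ)
    (h : (s : Set ι).PairwiseDisjoint A) :
    ∑ i ∈ s, lowerDensity (A i) ≤ lowerDensity (⋃ i ∈ s, A i) := by
  classical
  induction s using Finset.induction_on with
  | empty => simpa using lowerDensity_nonneg ∅
  | insert a s ha ih =>
    rw [Finset.sum_insert ha, Finset.set_biUnion_insert]
    rw [Finset.coe_insert] at h
    refine (add_le_add_right (ih (h.subset (Set.subset_insert _ _))) _).trans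
      (lowerDensity_add_le ?_)
    rw [Set.disjoint_iUnion₂_right]
    exact fun i hi => h (Set.mem_insert _ _) (Set.mem_insert_of_mem _ hi)
      (ne_of_mem_of_not_mem hi ha).symm

lemma lowerDensity_le_of_finite_diff {A B : Set ℕ} (h : (A \ B).Finite) :
    lowerDensity A ≤ lowerDensity B := by
  have hC : Tendsto (fun n : ℕ => -((A \ B).ncard : ℝ) / n) atTop (𝓝 0) :=
    tendsto_const_div_atTop_nhds_zero_nat _
  have hle : ∀ n : ℕ, ((fun n : ℕ => (Nat.card ↥(A ∩ Set.Icc 1 n) : ℝ) / n) +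
      fun n : ℕ => -((A \ B).ncard : ℝ) / n) n ≤ (Nat.card ↥(B ∩ Set.Icc 1 n) : ℝ) / n := by
    intro n
    simp only [Pi.add_apply, ← add_div]
    refine div_le_div_of_nonneg_right ?_ (Nat.cast_nonneg n)
    have hB := (Set.finite_Icc 1 n).inter_of_right B
    have hsub : A ∩ Set.Icc 1 n ⊆ B ∩ Set.Icc 1 n ∪ A \ B := by
      rintro m ⟨hA, hm⟩
      by_cases hmB : m ∈ B
      · exact Or.inl ⟨hmB, hm⟩
      · exact Or.inr ⟨hA, hmB⟩
    have hcard := (Set.ncard_le_ncard hsub (hB.union h)).trans (Set.ncard_union_le _ _)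
    simp only [Nat.card_coe_set_eq]
    rify at hcard
    linarith
  have hadd := le_liminf_add (isBoundedUnder_ge_density A) (isBoundedUnder_le_density A)
    hC.isBoundedUnder_ge hC.isBoundedUnder_le.isCoboundedUnder_ge
  rw [hC.liminf_eq, add_zero] at hadd
  exact hadd.trans (liminf_le_liminf (Eventually.of_forall hle)
    (isBoundedUnder_ge_add (isBoundedUnder_ge_density A) hC.isBoundedUnder_ge)
    (isBoundedUnder_le_density B).isCoboundedUnder_ge)

lemma upperDensity_setOf_le_abs_sub (x : ℕ → ℝ) (c ε : ℝ) :
    upperDensity {n | ε ≤ |x n - c|} = 1 - lowerDensity (x ⁻¹' Metric.ball c ε) := by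
  rw [← upperDensity_compl]
  congr 1
  ext n
  simp [Real.dist_eq]

lemma convIndex_eq_one_sub_iSup (x : ℕ → ℝ) (c : ℝ) :
    convIndex x c = 1 - ⨆ ε : {e : ℝ // 0 < e}, (1 - lowerDensity (x ⁻¹' Metric.ball c ε.1)) := by
  simp only [convIndex, upperDensity_setOf_le_abs_sub]

lemma convIndex_le_lowerDensity_preimage (x : ℕ → ℝ) {c : ℝ} {U : Set ℝ} (hU : U ∈ 𝓝 c) :
    convIndex x c ≤ lowerDensity (x ⁻¹' U) := by
  obtain ⟨ε, hε, hball⟩ := Metric.mem_nhds_iff.1 hU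
  have hbdd : BddAbove (Set.range fun ε : {e : ℝ // 0 < e} =>
      1 - lowerDensity (x ⁻¹' Metric.ball c ε.1)) := by
    refine ⟨1, ?_⟩
    rintro _ ⟨δ, rfl⟩
    exact sub_le_self _ (lowerDensity_nonneg _)
  have hsup := le_ciSup hbdd ⟨ε, hε⟩
  have hmono : lowerDensity (x ⁻¹' Metric.ball c ε) ≤ lowerDensity (x ⁻¹' U) := by
    refine lowerDensity_le_of_finite_diff ?_
    rw [Set.sdiff_eq_empty.2 (Set.preimage_mono hball)]
    exact Set.finite_empty
  rw [convIndex_eq_one_sub_iSup]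
  dsimp only at hsup
  linarith

lemma le_convIndex (x : ℕ → ℝ) (c : ℝ) {a : ℝ}
    (ha : ∀ ε > 0, a ≤ lowerDensity (x ⁻¹' Metric.ball c ε)) : a ≤ convIndex x c := by
  have : Nonempty {e : ℝ // 0 < e} := ⟨⟨1, one_pos⟩⟩
  rw [convIndex_eq_one_sub_iSup, le_sub_comm]
  exact ciSup_le fun ε => sub_le_sub_left (ha ε.1 ε.2) 1

lemma convIndex_nonneg (x : ℕ → ℝ) (c : ℝ) : 0 ≤ convIndex x c :=
  le_convIndex x c fun _ _ => lowerDensity_nonneg _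

lemma sum_convIndex_le_one (x : ℕ → ℝ) (s : Finset ℝ) : ∑ c ∈ s, convIndex x c ≤ 1 := by
  obtain ⟨U, hU, hdisj⟩ := s.finite_toSet.t2_separation
  calc ∑ c ∈ s, convIndex x c ≤ ∑ c ∈ s, lowerDensity (x ⁻¹' U c) :=
        Finset.sum_le_sum fun c _ =>
          convIndex_le_lowerDensity_preimage x ((hU c).2.mem_nhds (hU c).1)
    _ ≤ lowerDensity (⋃ c ∈ s, x ⁻¹' U c) :=
        sum_lowerDensity_le s _ fun a ha b hb hab => (hdisj ha hb hab).preimage x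
    _ ≤ 1 := lowerDensity_le_one _

lemma lowerDensity_range_le_convIndex (x : ℕ → ℝ) (c : ℝ) (k : ℕ → ℕ)
    (hk : Tendsto (fun n => x (k n)) atTop (𝓝 c)) :
    lowerDensity (Set.range k) ≤ convIndex x c := by
  refine le_convIndex x c fun ε hε => lowerDensity_le_of_finite_diff ?_
  obtain ⟨N, hN⟩ := eventually_atTop.1 (hk.eventually (Metric.ball_mem_nhds c hε))
  refine ((Set.finite_Iio N).image k).subset ?_
  rintro _ ⟨⟨n, rfl⟩, hn⟩
  exact ⟨n, not_le.1 fun h => hn (hN n h), rfl⟩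

theorem convIndex_eq_zero_of_hasSum_one (x : ℕ → ℝ) (L : ℕ → ℝ) (α : ℕ → ℝ)
    (hL : Function.Injective L) (hα : ∀ m, 0 ≤ α m)
    (h : ∀ m, convIndex x (L m) = α m) (hsum : HasSum α 1)
    (M : ℝ) (hM : ∀ m, M ≠ L m) :
    convIndex x M = 0 ∧
      ∀ k : ℕ → ℕ, StrictMono k → Tendsto (fun n => x (k n)) atTop (𝓝 M) →
        lowerDensity (Set.range k) = 0 := by
  have hzero : convIndex x M = 0 := by
    refine le_antisymm ?_ (convIndex_nonneg x M)
    have hle : (1 : ℝ) ≤ 1 - convIndex x M := by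
      refine le_of_tendsto hsum (Eventually.of_forall fun s => ?_)
      have hs := sum_convIndex_le_one x (insert M (s.image L))
      rw [Finset.sum_insert (by simpa using fun m _ => (hM m).symm),
        Finset.sum_image hL.injOn, Finset.sum_congr rfl fun m _ => h m] at hs
      linarith
    linarith
  exact ⟨hzero, fun k _ hk => le_antisymm
    (hzero ▸ lowerDensity_range_le_convIndex x M k hk) (lowerDensity_nonneg _)⟩
end
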